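/- arXiv:0711.4401 — 16 statements merged into one kernel-verified Lean document; each statement's English description precedes it below -/
import Mathlib

section
/- Let X be a frame equipped with a B-module action • : B → X → X (not assumed to satisfy stability). If there exists a monotone map ς : X → B which is equivariant (ς(b•x) = b ⊓ ς(x) for all b, x) and satisfies ς(x)•x = x for all x ∈ X, then the stability law b•x = (b•⊤) ⊓ x holds for all b ∈ B and x ∈ X; consequently b ↦ b•⊤ is a frame homomorphism and X is an open B-locale with support ς. -/
/-- a frame `X` with a `B`-module action admitting a monotone
equivariant `ς` with `ς x • x = x` automatically satisfies the stability law;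
consequently `b ↦ b • ⊤` is a frame homomorphism and `X` is an open `B`-locale
with support `ς`. -/
theorem sheaves_as_modules_stmt2 {B X : Type*} [Order.Frame B] [Order.Frame X]
    (smul : B → X → X)
    (h1 : ∀ x : X, smul ⊤ x = x)
    (h2 : ∀ (a b : B) (x : X), smul (a ⊓ b) x = smul a (smul b x))
    (h3 : ∀ (S : Set B) (x : X), smul (sSup S) x = ⨆ b ∈ S, smul b x)
    (h4 : ∀ (b : B) (T : Set X), smul b (sSup T) = ⨆ x ∈ T, smul b x)
    (ς : X → B) (hmono : Monotone ς)
    (hequiv : ∀ (b : B) (x : X), ς (smul b x) = b ⊓ ς x)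
    (hsupp : ∀ x : X, smul (ς x) x = x) :
    -- stability
    (∀ (b : B) (x : X), smul b x = smul b ⊤ ⊓ x) ∧
    -- b ↦ b • ⊤ is a frame homomorphism
    (∀ S : Set B, smul (sSup S) (⊤ : X) = ⨆ b ∈ S, smul b ⊤) ∧
    (∀ a b : B, smul (a ⊓ b) (⊤ : X) = smul a ⊤ ⊓ smul b ⊤) ∧
    smul ⊤ (⊤ : X) = ⊤ ∧
    -- ς is left adjoint to b ↦ b • ⊤ (so X is an open B-locale) …
    (∀ (x : X) (b : B), ς x ≤ b ↔ x ≤ smul b ⊤) ∧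
    -- … and ς is equivariant for the associated B-locale action
    (∀ (b : B) (x : X), ς (smul b ⊤ ⊓ x) = b ⊓ ς x) := by
  have smul_mono : ∀ {a b : B} {x y : X}, a ≤ b → x ≤ y → smul a x ≤ smul b y := by
    intro a b x y hab hxy
    calc smul a x ≤ smul b x := by
          have h := h3 {a, b} x
          rw [sSup_pair, sup_eq_right.mpr hab, iSup_pair] at h
          exact h ▸ le_sup_left
      _ ≤ smul b y := by
          have h := h4 b {x, y}
          rw [sSup_pair, sup_eq_right.mpr hxy, iSup_pair] at h
          exact h ▸ le_sup_left
  have adj : ∀ (x : X) (b : B), ς x ≤ b ↔ x ≤ smul b ⊤ := fun x b =>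
    ⟨fun h => (hsupp x).ge.trans (smul_mono h le_top),
      fun h => (hmono h).trans ((hequiv b ⊤).le.trans inf_le_left)⟩
  have stable : ∀ (b : B) (x : X), smul b x = smul b ⊤ ⊓ x := fun b x =>
    le_antisymm
      (le_inf (smul_mono le_rfl le_top) ((smul_mono le_top le_rfl).trans (h1 x).le))
      ((hsupp _).ge.trans (smul_mono ((adj _ b).mpr inf_le_left) inf_le_right))
  exact ⟨stable, fun S => h3 S ⊤, fun a b => (h2 a b ⊤).trans (stable a _), h1 ⊤, adj,
    fun b x => stable b x ▸ hequiv b x⟩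
end

section
/- Let X and Y be open B-locales with frame homomorphisms φ_X : B → X, φ_Y : B → Y and supports ς_X, ς_Y. Let f* : Y → X be a frame homomorphism with f* ∘ φ_Y = φ_X, and suppose f* has a left adjoint f_! : X → Y satisfying the Frobenius condition f_!(x ⊓ f*(y)) = f_!(x) ⊓ y for all x ∈ X, y ∈ Y. Then: (i) ς_Y(f_!(x)) = ς_X(x) for all x ∈ X; (ii) f_!(φ_X(b) ⊓ x) = φ_Y(b) ⊓ f_!(x) for all b ∈ B, x ∈ X; (iii) if s is a local section of X then f_!(s) is a local section of Y. -/
/-- for a map `f` of open `B`-locales (a frame homomorphism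
`f* : Y → X` over `B` with a left adjoint `f_!` satisfying Frobenius
reciprocity): `f_!` preserves supports, is `B`-equivariant, and maps local
sections to local sections. -/
theorem sheaves_as_modules_stmt4 {B X Y : Type*}
    [Order.Frame B] [Order.Frame X] [Order.Frame Y]
    (φX : B → X) (φY : B → Y) (ςX : X → B) (ςY : Y → B)
    (hφXS : ∀ S : Set B, φX (sSup S) = ⨆ b ∈ S, φX b)
    (hφXI : ∀ a b : B, φX (a ⊓ b) = φX a ⊓ φX b)
    (hφXT : φX ⊤ = ⊤)
    (hφYS : ∀ S : Set B, φY (sSup S) = ⨆ b ∈ S, φY b)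
    (hφYI : ∀ a b : B, φY (a ⊓ b) = φY a ⊓ φY b)
    (hφYT : φY ⊤ = ⊤)
    (hadjX : ∀ (x : X) (b : B), ςX x ≤ b ↔ x ≤ φX b)
    (hequivX : ∀ (b : B) (x : X), ςX (φX b ⊓ x) = b ⊓ ςX x)
    (hadjY : ∀ (y : Y) (b : B), ςY y ≤ b ↔ y ≤ φY b)
    (hequivY : ∀ (b : B) (y : Y), ςY (φY b ⊓ y) = b ⊓ ςY y)
    (fs : Y → X) (fl : X → Y)
    (hfsS : ∀ S : Set Y, fs (sSup S) = ⨆ y ∈ S, fs y)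
    (hfsI : ∀ a b : Y, fs (a ⊓ b) = fs a ⊓ fs b)
    (hfsT : fs ⊤ = ⊤)
    (hover : ∀ b : B, fs (φY b) = φX b)
    (hadjf : ∀ (x : X) (y : Y), fl x ≤ y ↔ x ≤ fs y)
    (hfrob : ∀ (x : X) (y : Y), fl (x ⊓ fs y) = fl x ⊓ y) :
    -- (i) f_! preserves supports
    (∀ x : X, ςY (fl x) = ςX x) ∧
    -- (ii) f_! is B-equivariant
    (∀ (b : B) (x : X), fl (φX b ⊓ x) = φY b ⊓ fl x) ∧
    -- (iii) f_! maps local sections to local sections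
    (∀ s : X, (∀ x ≤ s, φX (ςX x) ⊓ s = x) →
      (∀ y ≤ fl s, φY (ςY y) ⊓ fl s = y)) := by
  have hsupp : ∀ x : X, ςY (fl x) = ςX x := fun x =>
    eq_of_forall_ge_iff fun b => by rw [hadjY, hadjf, hover, hadjX]
  have hequiv : ∀ (b : B) (x : X), fl (φX b ⊓ x) = φY b ⊓ fl x := fun b x => by
    rw [inf_comm, ← hover, hfrob, inf_comm]
  refine ⟨hsupp, hequiv, fun s hs y hy => ?_⟩
  have hfl : fl (s ⊓ fs y) = y := by rw [hfrob, inf_eq_right.mpr hy]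
  calc φY (ςY y) ⊓ fl s = fl (φX (ςX (s ⊓ fs y)) ⊓ s) := by rw [hequiv, ← hsupp, hfl]
    _ = y := by rw [hs _ inf_le_left, hfl]
end

section
/- Let X be a Hilbert B-module. Then for all b ∈ B and x ∈ X one has b•x = (b•⊤) ⊓ x, where ⊓ is the meet of the complete lattice X. -/
/-- A map between complete lattices that preserves arbitrary suprema is monotone. -/
lemma monotone_of_map_sSup_eq_biSup {α β : Type*} [CompleteLattice α] [CompleteLattice β]
    {f : α → β} (hf : ∀ S : Set α, f (sSup S) = ⨆ a ∈ S, f a) : Monotone f := by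
  intro a b hab
  have h := hf {a, b}
  rw [sSup_pair, iSup_pair, sup_eq_right.2 hab] at h
  exact h ▸ le_sup_left

/-- in a Hilbert `B`-module the stability law `b • x = (b • ⊤) ⊓ x`
holds automatically. -/
theorem sheaves_as_modules_stmt5 {B X : Type*} [Order.Frame B] [CompleteLattice X]
    (smul : B → X → X) (inn : X → X → B)
    (h1 : ∀ x : X, smul ⊤ x = x)
    (h2 : ∀ (a b : B) (x : X), smul (a ⊓ b) x = smul a (smul b x))
    (h3 : ∀ (S : Set B) (x : X), smul (sSup S) x = ⨆ b ∈ S, smul b x)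
    (h4 : ∀ (b : B) (T : Set X), smul b (sSup T) = ⨆ x ∈ T, smul b x)
    (hi1 : ∀ (b : B) (x y : X), inn (smul b x) y = b ⊓ inn x y)
    (hi2 : ∀ (T : Set X) (y : X), inn (sSup T) y = ⨆ x ∈ T, inn x y)
    (hi3 : ∀ x y : X, inn x y = inn y x)
    (hnd : ∀ x y : X, (∀ z : X, inn x z = inn y z) → x = y) :
    ∀ (b : B) (x : X), smul b x = smul b ⊤ ⊓ x := by
  intro b x
  have smul_mono (c : B) : Monotone (smul c) := monotone_of_map_sSup_eq_biSup (h4 c)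
  have inn_mono (z : X) : Monotone fun y => inn y z :=
    monotone_of_map_sSup_eq_biSup fun T => hi2 T z
  have smul_le_self : smul b x ≤ x := by
    have h : Monotone fun c => smul c x := monotone_of_map_sSup_eq_biSup fun S => h3 S x
    simpa only [h1] using h (le_top : b ≤ ⊤)
  refine le_antisymm (le_inf (smul_mono b le_top) smul_le_self) ?_
  have smul_fixes : smul b (smul b ⊤ ⊓ x) = smul b ⊤ ⊓ x := by
    refine hnd _ _ fun z => ?_
    rw [hi1, inf_eq_right]
    calc inn (smul b ⊤ ⊓ x) z ≤ inn (smul b ⊤) z := inn_mono z inf_le_left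
      _ = b ⊓ inn ⊤ z := hi1 b ⊤ z
      _ ≤ b := inf_le_left
  exact smul_fixes.ge.trans (smul_mono b inf_le_right)
end

section
/- Let X be an open B-locale with frame homomorphism φ, action b•x = φ(b) ⊓ x, and support ς. Define ⟨x,y⟩ := ς(x ⊓ y) for x, y ∈ X. Then ⟨-,-⟩ makes X a supported pre-Hilbert B-module: ⟨b•x, y⟩ = b ⊓ ⟨x,y⟩, ⟨⨆_α x_α, y⟩ = ⨆_α⟨x_α, y⟩, ⟨x,y⟩ = ⟨y,x⟩ and ⟨x,x⟩•x = x for all x; moreover this inner product is weakly non-degenerate: if ⟨x,z⟩ = ⟨y,z⟩ for all z ∈ X, then the Heyting pseudo-complements agree, ¬x = ¬y (where ¬x = x ⇨ ⊥). -/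
/-- an open `B`-locale is a supported pre-Hilbert `B`-module with
inner product `⟨x,y⟩ = ς (x ⊓ y)`, and this inner product is weakly
non-degenerate: equal inner products against all `z` imply equal Heyting
pseudo-complements. -/
theorem sheaves_as_modules_stmt7 {B X : Type*} [Order.Frame B] [Order.Frame X]
    (φ : B → X) (ς : X → B)
    (hφS : ∀ S : Set B, φ (sSup S) = ⨆ b ∈ S, φ b)
    (hφI : ∀ a b : B, φ (a ⊓ b) = φ a ⊓ φ b)
    (hφT : φ ⊤ = ⊤)
    (hadj : ∀ (x : X) (b : B), ς x ≤ b ↔ x ≤ φ b)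
    (hequiv : ∀ (b : B) (x : X), ς (φ b ⊓ x) = b ⊓ ς x) :
    -- ⟨b • x, y⟩ = b ⊓ ⟨x, y⟩
    (∀ (b : B) (x y : X), ς ((φ b ⊓ x) ⊓ y) = b ⊓ ς (x ⊓ y)) ∧
    -- ⟨⨆ T, y⟩ = ⨆_{x ∈ T} ⟨x, y⟩
    (∀ (T : Set X) (y : X), ς (sSup T ⊓ y) = ⨆ x ∈ T, ς (x ⊓ y)) ∧
    -- symmetry
    (∀ x y : X, ς (x ⊓ y) = ς (y ⊓ x)) ∧
    -- supportedness: ⟨x,x⟩ • x = x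
    (∀ x : X, φ (ς (x ⊓ x)) ⊓ x = x) ∧
    -- weak non-degeneracy
    (∀ x y : X, (∀ z : X, ς (x ⊓ z) = ς (y ⊓ z)) → (x ⇨ ⊥) = (y ⇨ ⊥)) := by
  have gc : GaloisConnection ς φ := hadj
  have hφ_bot : φ ⊥ = ⊥ := by simpa using hφS ∅
  have hς_bot (w : X) : ς w = ⊥ ↔ w = ⊥ := by
    rw [← le_bot_iff, hadj, hφ_bot, le_bot_iff]
  refine ⟨fun b x y => ?_, fun T y => ?_, fun x y => ?_, fun x => ?_, fun x y h => ?_⟩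
  · rw [inf_assoc, hequiv]
  · rw [sSup_inf_eq, gc.l_iSup₂]
  · rw [inf_comm]
  · rw [inf_idem]
    exact inf_eq_right.mpr (gc.le_u_l x)
  · refine eq_of_forall_le_iff fun z => ?_
    rw [le_himp_iff, le_himp_iff, le_bot_iff, le_bot_iff, inf_comm z x, inf_comm z y,
      ← hς_bot, h z, hς_bot]
end

section
/- Let X be a pre-Hilbert B-module with a Hilbert basis 𝒮 ⊆ X. Then for all x, y ∈ X: (1) ⨆𝒮 = ⊤; (2) if ⟨x,s⟩ = ⟨y,s⟩ for all s ∈ 𝒮 then x = y (so the inner product is non-degenerate); (3) ⟨x,y⟩ = ⨆_{s∈𝒮} (⟨x,s⟩ ⊓ ⟨s,y⟩); (4) ⟨x,x⟩•x = x; (5) ⟨x,y⟩ ≤ ⟨x,x⟩. -/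
/-- basic consequences of the existence of a Hilbert basis `𝒮` of
a pre-Hilbert `B`-module `X`. -/
theorem sheaves_as_modules_stmt8 {B X : Type*} [Order.Frame B] [CompleteLattice X]
    (smul : B → X → X) (inn : X → X → B)
    (h1 : ∀ x : X, smul ⊤ x = x)
    (h2 : ∀ (a b : B) (x : X), smul (a ⊓ b) x = smul a (smul b x))
    (h3 : ∀ (S : Set B) (x : X), smul (sSup S) x = ⨆ b ∈ S, smul b x)
    (h4 : ∀ (b : B) (T : Set X), smul b (sSup T) = ⨆ x ∈ T, smul b x)
    (hi1 : ∀ (b : B) (x y : X), inn (smul b x) y = b ⊓ inn x y)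
    (hi2 : ∀ (T : Set X) (y : X), inn (sSup T) y = ⨆ x ∈ T, inn x y)
    (hi3 : ∀ x y : X, inn x y = inn y x)
    (𝒮 : Set X)
    (hbasis : ∀ x : X, x = ⨆ s ∈ 𝒮, smul (inn x s) s) :
    -- (1) 𝒮 is a cover
    sSup 𝒮 = ⊤ ∧
    -- (2) non-degeneracy on basis elements
    (∀ x y : X, (∀ s ∈ 𝒮, inn x s = inn y s) → x = y) ∧
    -- (3) the inner product is computed through the basis
    (∀ x y : X, inn x y = ⨆ s ∈ 𝒮, inn x s ⊓ inn s y) ∧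
    -- (4) X is supported
    (∀ x : X, smul (inn x x) x = x) ∧
    -- (5) ⟨x,y⟩ ≤ ⟨x,x⟩
    (∀ x y : X, inn x y ≤ inn x x) := by
  have smul_le (b : B) (x : X) : smul b x ≤ x := by
    have h := h3 {b, ⊤} x
    rw [sSup_pair, sup_top_eq, h1, iSup_pair, h1] at h
    exact le_sup_left.trans h.ge
  have ext_basis (x y : X) (h : ∀ s ∈ 𝒮, inn x s = inn y s) : x = y := by
    rw [hbasis x, hbasis y]
    exact iSup_congr fun s => iSup_congr fun hs => by rw [h s hs]
  have parseval (x y : X) : inn x y = ⨆ s ∈ 𝒮, inn x s ⊓ inn s y := by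
    conv_lhs => rw [hbasis x, ← sSup_image, hi2, iSup_image]
    simp only [hi1]
  have inn_le_self (x y : X) : inn x y ≤ inn x x := by
    rw [parseval x y, parseval x x]
    exact iSup₂_mono fun s _ => le_inf inf_le_left (inf_le_left.trans (hi3 x s).le)
  refine ⟨?_, ext_basis, parseval, fun x => ext_basis _ _ fun s _ => ?_, inn_le_self⟩
  · rw [eq_top_iff, hbasis ⊤, sSup_eq_iSup]
    exact iSup₂_mono fun s _ => smul_le _ s
  · rw [hi1, inf_eq_right]
    exact inn_le_self x s
end

section
/- Let X be a pre-Hilbert B-module with a Hilbert basis 𝒮 ⊆ X. Then for every s ∈ 𝒮 and every x ∈ X the following three conditions are equivalent: (a) x ≤ s; (b) x = ⟨x,x⟩•s; (c) x = ⟨x,s⟩•s. -/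
/-- A map between complete lattices that preserves suprema of sets is monotone. -/
theorem monotone_of_map_sSup {X Y : Type*} [CompleteLattice X] [CompleteLattice Y] {f : X → Y}
    (hf : ∀ T : Set X, f (sSup T) = ⨆ x ∈ T, f x) : Monotone f := by
  intro x y hxy
  have h := hf {x, y}
  rw [sSup_pair, sup_eq_right.mpr hxy, iSup_pair] at h
  exact h ▸ le_sup_left

/-- in a pre-Hilbert `B`-module with Hilbert basis `𝒮`, for every
basis element `s` and every `x` the conditions `x ≤ s`, `x = ⟨x,x⟩ • s` and
`x = ⟨x,s⟩ • s` are equivalent. -/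
theorem sheaves_as_modules_stmt9 {B X : Type*} [Order.Frame B] [CompleteLattice X]
    (smul : B → X → X) (inn : X → X → B)
    (h1 : ∀ x : X, smul ⊤ x = x)
    (h2 : ∀ (a b : B) (x : X), smul (a ⊓ b) x = smul a (smul b x))
    (h3 : ∀ (S : Set B) (x : X), smul (sSup S) x = ⨆ b ∈ S, smul b x)
    (h4 : ∀ (b : B) (T : Set X), smul b (sSup T) = ⨆ x ∈ T, smul b x)
    (hi1 : ∀ (b : B) (x y : X), inn (smul b x) y = b ⊓ inn x y)
    (hi2 : ∀ (T : Set X) (y : X), inn (sSup T) y = ⨆ x ∈ T, inn x y)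
    (hi3 : ∀ x y : X, inn x y = inn y x)
    (𝒮 : Set X)
    (hbasis : ∀ x : X, x = ⨆ s ∈ 𝒮, smul (inn x s) s) :
    ∀ s ∈ 𝒮, ∀ x : X,
      ((x ≤ s ↔ x = smul (inn x x) s) ∧
       (x ≤ s ↔ x = smul (inn x s) s)) := by
  have smul_mono_left (x : X) : Monotone (smul · x) := monotone_of_map_sSup (h3 · x)
  have smul_mono_right (b : B) : Monotone (smul b) := monotone_of_map_sSup (h4 b)
  have inn_mono_left (y : X) : Monotone (inn · y) := monotone_of_map_sSup (hi2 · y)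
  have smul_le (b : B) (x : X) : smul b x ≤ x :=
    (smul_mono_left x le_top).trans_eq (h1 x)
  have smul_inn_le (x : X) {t : X} (ht : t ∈ 𝒮) : smul (inn x t) t ≤ x :=
    (le_iSup₂ (f := fun t (_ : t ∈ 𝒮) => smul (inn x t) t) t ht).trans_eq (hbasis x).symm
  have inn_le_self (x : X) {t : X} (ht : t ∈ 𝒮) : inn x t ≤ inn x x := by
    have h := inn_mono_left x (smul_inn_le x ht)
    simpa only [hi1, hi3 t x, inf_idem] using h
  have le_smul_self (x : X) : x ≤ smul (inn x x) x := by
    conv_lhs => rw [hbasis x]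
    refine iSup₂_le fun t ht => ?_
    rw [← inf_eq_right.mpr (inn_le_self x ht), h2]
    exact smul_mono_right _ (smul_inn_le x ht)
  intro s hs x
  have inn_eq (hx : x ≤ s) : inn x x = inn x s :=
    le_antisymm ((inn_mono_left x hx).trans_eq (hi3 s x)) (inn_le_self x hs)
  have eq_smul (hx : x ≤ s) : x = smul (inn x s) s :=
    le_antisymm (inn_eq hx ▸ (le_smul_self x).trans (smul_mono_right _ hx)) (smul_inn_le x hs)
  exact ⟨⟨fun hx => (inn_eq hx).symm ▸ eq_smul hx, fun hx => hx.trans_le (smul_le _ s)⟩,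
    ⟨eq_smul, fun hx => hx.trans_le (smul_le _ s)⟩⟩
end

section
/- Let X be a pre-Hilbert B-module whose inner product is non-degenerate, and let 𝒮 ⊆ X be a subset such that ⟨x,y⟩ = ⨆_{s∈𝒮} (⟨x,s⟩ ⊓ ⟨s,y⟩) for all x, y ∈ X. Then 𝒮 is a Hilbert basis of X, i.e. x = ⨆_{s∈𝒮} ⟨x,s⟩•s for all x ∈ X. -/
/-- if the inner product of a pre-Hilbert `B`-module is
non-degenerate and `⟨x,y⟩ = ⨆_{s∈𝒮} (⟨x,s⟩ ⊓ ⟨s,y⟩)` for all `x, y`, then `𝒮`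
is a Hilbert basis. -/
theorem sheaves_as_modules_stmt10 {B X : Type*} [Order.Frame B] [CompleteLattice X]
    (smul : B → X → X) (inn : X → X → B)
    (h1 : ∀ x : X, smul ⊤ x = x)
    (h2 : ∀ (a b : B) (x : X), smul (a ⊓ b) x = smul a (smul b x))
    (h3 : ∀ (S : Set B) (x : X), smul (sSup S) x = ⨆ b ∈ S, smul b x)
    (h4 : ∀ (b : B) (T : Set X), smul b (sSup T) = ⨆ x ∈ T, smul b x)
    (hi1 : ∀ (b : B) (x y : X), inn (smul b x) y = b ⊓ inn x y)
    (hi2 : ∀ (T : Set X) (y : X), inn (sSup T) y = ⨆ x ∈ T, inn x y)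
    (hi3 : ∀ x y : X, inn x y = inn y x)
    (hnd : ∀ x y : X, (∀ z : X, inn x z = inn y z) → x = y)
    (𝒮 : Set X)
    (hmat : ∀ x y : X, inn x y = ⨆ s ∈ 𝒮, inn x s ⊓ inn s y) :
    ∀ x : X, x = ⨆ s ∈ 𝒮, smul (inn x s) s := by
  intro x
  refine hnd _ _ fun z => ?_
  rw [← sSup_image, hi2, iSup_image, hmat x z]
  simp only [hi1]
end

section
/- Let S be a set and M : S × S → B a B-valued projection matrix, i.e. m_{s t} = m_{t s} and m_{s t} = ⨆_{u∈S}(m_{s u} ⊓ m_{u t}) for all s, t ∈ S. On the set of functions S → B define (Mf)(s) = ⨆_{t∈S}(m_{s t} ⊓ f(t)), the action (b•f)(s) = b ⊓ f(s), and the inner product ⟨f,g⟩ = ⨆_{s∈S}(f(s) ⊓ g(s)). For each s ∈ S let s̃ : S → B be the column s̃(t) = m_{t s}. Then: (1) M s̃ = s̃, so s̃ lies in the set MB^S = {Mf | f : S → B}; (2) for every f : S → B and s ∈ S, ⟨Mf, s̃⟩ = (Mf)(s); (3) Mf = ⨆_{s∈S} ⟨Mf, s̃⟩•s̃, so {s̃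 | s ∈ S} is a Hilbert basis of MB^S and the inner product is non-degenerate on MB^S; (4) ⟨s̃, t̃⟩ = m_{s t} for all s, t ∈ S. -/
/-- every `B`-valued projection matrix `M` on a set `S` yields a
Hilbert `B`-module `M B^S` whose columns form a Hilbert basis, and the matrix
is recovered as the metric of the inner product. -/
theorem sheaves_as_modules_stmt11 {B : Type*} [Order.Frame B] {S : Type*}
    (m : S → S → B)
    (hsym : ∀ s t : S, m s t = m t s)
    (hidem : ∀ s t : S, m s t = ⨆ u : S, m s u ⊓ m u t) :
    -- M, the inner product, the action, and the columns of M
    let M : (S → B) → (S → B) := fun f s => ⨆ t : S, m s t ⊓ f t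
    let inn : (S → B) → (S → B) → B := fun f g => ⨆ s : S, f s ⊓ g s
    let smul : B → (S → B) → (S → B) := fun b f s => b ⊓ f s
    let col : S → (S → B) := fun s t => m t s
    -- (1) each column lies in M B^S
    (∀ s : S, M (col s) = col s) ∧
    -- (2) ⟨Mf, s̃⟩ = (Mf)(s)
    (∀ (f : S → B) (s : S), inn (M f) (col s) = M f s) ∧
    -- (3) the columns form a Hilbert basis of M B^S …
    (∀ f : S → B, M f = ⨆ s : S, smul (inn (M f) (col s)) (col s)) ∧
    -- … and the inner product is non-degenerate on M B^S
    (∀ f g : S → B, (∀ h : S → B, inn (M f) (M h) = inn (M g) (M h)) → M f = M g) ∧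
    -- (4) the metric of the inner product is M
    (∀ s t : S, inn (col s) (col t) = m s t) := by
  intro M inn smul col
  have M_M (f : S → B) : M (M f) = M f := by
    funext s
    calc (⨆ t, m s t ⊓ ⨆ u, m t u ⊓ f u) = ⨆ u, ⨆ t, (m s t ⊓ m t u) ⊓ f u := by
          simp only [inf_iSup_eq, inf_assoc]
          exact iSup_comm
      _ = ⨆ u, m s u ⊓ f u := by
          simp only [← iSup_inf_eq, ← hidem]
  have M_col (s : S) : M (col s) = col s := funext fun t => (hidem t s).symm
  have inn_col (f : S → B) (s : S) : inn f (col s) = M f s :=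
    iSup_congr fun t => by rw [inf_comm, hsym s t]
  have inn_M_col (f : S → B) (s : S) : inn (M f) (col s) = M f s := by
    rw [inn_col, M_M]
  refine ⟨M_col, inn_M_col, fun f => ?_, fun f g h => ?_, fun s t => ?_⟩
  · funext s
    simp only [inn_M_col, iSup_apply]
    rw [← congrFun (M_M f) s]
    exact iSup_congr fun t => inf_comm _ _
  · funext s
    rw [← inn_M_col f s, ← inn_M_col g s, ← M_col s]
    exact h (col s)
  · rw [inn_col, M_col, hsym s t]
end

section
/- Let X be a Hilbert B-module with a Hilbert basis 𝒮 ⊆ X, and let M : 𝒮 × 𝒮 → B be the matrix m_{s t} = ⟨s,t⟩, acting on functions f : 𝒮 → B by (Mf)(s) = ⨆_{t∈𝒮}(m_{s t} ⊓ f(t)). Then the map ψ : X → (𝒮 → B) defined by ψ(x)(s) = ⟨x,s⟩ is an order embedding (x ≤ y if and only if ψ(x) ≤ ψ(y) pointwise) whose image is exactly {f : 𝒮 → B | Mf = f} = {Mf | f : 𝒮 → B}; consequently X satisfies the frame distributive law x ⊓ ⨆T = ⨆_{t∈T}(x ⊓ t) for all x ∈ X and T ⊆ X (X is a frame), and b•x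 = (b•⊤) ⊓ x for all b, x, so X is a B-locale. -/
/-- a Hilbert `B`-module `X` with Hilbert basis `𝒮` embeds, via
`ψ x = ⟨x,-⟩`, order-isomorphically onto the module of fixed points of the
projection matrix `M = (⟨s,t⟩)`; consequently `X` is a frame and a `B`-locale. -/
theorem sheaves_as_modules_stmt12 {B X : Type*} [Order.Frame B] [CompleteLattice X]
    (smul : B → X → X) (inn : X → X → B)
    (h1 : ∀ x : X, smul ⊤ x = x)
    (h2 : ∀ (a b : B) (x : X), smul (a ⊓ b) x = smul a (smul b x))
    (h3 : ∀ (S : Set B) (x : X), smul (sSup S) x = ⨆ b ∈ S, smul b x)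
    (h4 : ∀ (b : B) (T : Set X), smul b (sSup T) = ⨆ x ∈ T, smul b x)
    (hi1 : ∀ (b : B) (x y : X), inn (smul b x) y = b ⊓ inn x y)
    (hi2 : ∀ (T : Set X) (y : X), inn (sSup T) y = ⨆ x ∈ T, inn x y)
    (hi3 : ∀ x y : X, inn x y = inn y x)
    (hnd : ∀ x y : X, (∀ z : X, inn x z = inn y z) → x = y)
    (𝒮 : Set X)
    (hbasis : ∀ x : X, x = ⨆ s ∈ 𝒮, smul (inn x s) s) :
    let M : (𝒮 → B) → (𝒮 → B) := fun f s => ⨆ t : 𝒮, inn (s : X) (t : X) ⊓ f t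
    let ψ : X → (𝒮 → B) := fun x s => inn x (s : X)
    -- ψ is an order embedding
    (∀ x y : X, x ≤ y ↔ ψ x ≤ ψ y) ∧
    -- whose image is the set of fixed points of M
    Set.range ψ = {f : 𝒮 → B | M f = f} ∧
    -- which is also the image of M
    Set.range ψ = Set.range M ∧
    -- consequently X satisfies the frame distributive law
    (∀ (x : X) (T : Set X), x ⊓ sSup T = ⨆ t ∈ T, x ⊓ t) ∧
    -- and the stability law, so X is a B-locale
    (∀ (b : B) (x : X), smul b x = smul b ⊤ ⊓ x) := by
  intro M ψ
  have inn_iSup : ∀ (g : 𝒮 → X) (y : X), inn (⨆ i, g i) y = ⨆ i, inn (g i) y := by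
    intro g y
    rw [iSup, hi2, iSup_range]
  have inn_mono : ∀ {x y : X} (z : X), x ≤ y → inn x z ≤ inn y z := by
    intro x y z hxy
    have h := hi2 {x, y} z
    rw [sSup_pair, sup_eq_right.2 hxy, iSup_pair] at h
    exact h ▸ le_sup_left
  have smul_mono : ∀ {a b : B} (x : X), a ≤ b → smul a x ≤ smul b x := by
    intro a b x hab
    have h := h3 {a, b} x
    rw [sSup_pair, sup_eq_right.2 hab, iSup_pair] at h
    exact h ▸ le_sup_left
  have basis_le : ∀ (x : X) (s : 𝒮), smul (inn x s) s ≤ x := by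
    intro x s
    conv_rhs => rw [hbasis x]
    exact le_iSup₂ (f := fun s (_ : s ∈ 𝒮) => smul (inn x s) s) s.1 s.2
  have le_iff : ∀ x y : X, x ≤ y ↔ ψ x ≤ ψ y := by
    refine fun x y => ⟨fun h s => inn_mono s h, fun h => ?_⟩
    rw [hbasis x]
    exact iSup₂_le fun s hs => (smul_mono s (h ⟨s, hs⟩)).trans (basis_le y ⟨s, hs⟩)
  have M_eq : ∀ f : 𝒮 → B, M f = ψ (⨆ t : 𝒮, smul (f t) t) := by
    intro f
    funext s
    simp only [M, ψ, inn_iSup, hi1]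
    exact iSup_congr fun t => by rw [inf_comm, hi3]
  have M_ψ : ∀ x : X, M (ψ x) = ψ x := by
    intro x
    rw [M_eq]
    congr 1
    conv_rhs => rw [hbasis x]
    exact iSup_subtype (f := fun t : 𝒮 => smul (ψ x t) t)
  have inn_le_self : ∀ (x : X) (s : 𝒮), inn x s ≤ inn (s : X) s := by
    intro x s
    have h_basis : ∀ t : 𝒮, inn (s : X) t ≤ inn (s : X) s := by
      intro t
      have h := inn_mono (s : X) (basis_le s t)
      rwa [hi1, hi3 t s, inf_idem] at h
    have h := congrFun (M_ψ x) s
    simp only [M, ψ] at h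
    rw [← h]
    exact iSup_le fun t => inf_le_left.trans (h_basis t)
  have inn_inf : ∀ (x y : X) (s : 𝒮), inn (x ⊓ y) s = inn x s ⊓ inn y s := by
    intro x y s
    refine le_antisymm (le_inf (inn_mono _ inf_le_left) (inn_mono _ inf_le_right)) ?_
    have h : smul (inn x s ⊓ inn y s) s ≤ x ⊓ y :=
      le_inf ((smul_mono _ inf_le_left).trans (basis_le x s))
        ((smul_mono _ inf_le_right).trans (basis_le y s))
    have h' := inn_mono (s : X) h
    rwa [hi1, inf_eq_left.2 (inf_le_left.trans (inn_le_self x s))] at h'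
  refine ⟨le_iff, ?_, ?_, fun x T => le_antisymm ?_ ?_, fun b x => le_antisymm ?_ ?_⟩
  · ext f
    refine ⟨?_, fun h => ⟨_, (M_eq f).symm.trans h⟩⟩
    rintro ⟨x, rfl⟩
    exact M_ψ x
  · ext f
    constructor
    · rintro ⟨x, rfl⟩
      exact ⟨_, M_ψ x⟩
    · rintro ⟨g, rfl⟩
      exact ⟨_, (M_eq g).symm⟩
  · refine (le_iff _ _).2 fun s => ?_
    change inn _ _ ≤ inn _ _
    rw [inn_inf, hi2, inf_iSup₂_eq]
    refine iSup₂_le fun t ht => ?_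
    rw [← inn_inf]
    exact inn_mono _ (le_iSup₂ (f := fun t (_ : t ∈ T) => x ⊓ t) t ht)
  · exact iSup₂_le fun t ht => inf_le_inf_left _ (le_sSup ht)
  all_goals
    refine (le_iff _ _).2 fun s => ?_
    change inn _ _ ≤ inn _ _
    rw [inn_inf, hi1, hi1]
  · exact le_inf (inf_le_inf_left _ (inn_mono _ le_top)) inf_le_right
  · exact inf_le_inf_right _ inf_le_left
end

section
/- Let X be an étale B-locale (an open B-locale whose local sections have join ⊤), with frame homomorphism φ, action b•x = φ(b) ⊓ x, and support ς. Define ⟨x,y⟩ := ς(x ⊓ y). Then the set 𝒮_X of local sections of X is a Hilbert basis for this inner product: x = ⨆_{s∈𝒮_X} ς(x ⊓ s)•s for every x ∈ X; moreover the inner product ⟨x,y⟩ = ς(x ⊓ y) is non-degenerate on X. -/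
/-- in an étale `B`-locale the set of local sections is a Hilbert
basis for the inner product `⟨x,y⟩ = ς (x ⊓ y)`, and this inner product is
non-degenerate. -/
theorem sheaves_as_modules_stmt13 {B X : Type*} [Order.Frame B] [Order.Frame X]
    (φ : B → X) (ς : X → B)
    (hφS : ∀ S : Set B, φ (sSup S) = ⨆ b ∈ S, φ b)
    (hφI : ∀ a b : B, φ (a ⊓ b) = φ a ⊓ φ b)
    (hφT : φ ⊤ = ⊤)
    (hadj : ∀ (x : X) (b : B), ς x ≤ b ↔ x ≤ φ b)
    (hequiv : ∀ (b : B) (x : X), ς (φ b ⊓ x) = b ⊓ ς x)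
    (hetale : sSup {s : X | ∀ x ≤ s, φ (ς x) ⊓ s = x} = ⊤) :
    -- the local sections form a Hilbert basis
    (∀ x : X, x = ⨆ s ∈ {s : X | ∀ x' ≤ s, φ (ς x') ⊓ s = x'}, φ (ς (x ⊓ s)) ⊓ s) ∧
    -- the inner product ⟨x,y⟩ = ς (x ⊓ y) is non-degenerate
    (∀ x y : X, (∀ z : X, ς (x ⊓ z) = ς (y ⊓ z)) → x = y) := by
  have hilbert_basis : ∀ x : X,
      x = ⨆ s ∈ {s : X | ∀ x' ≤ s, φ (ς x') ⊓ s = x'}, φ (ς (x ⊓ s)) ⊓ s := by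
    intro x
    calc x = x ⊓ sSup {s : X | ∀ x' ≤ s, φ (ς x') ⊓ s = x'} := by rw [hetale, inf_top_eq]
      _ = ⨆ s ∈ {s : X | ∀ x' ≤ s, φ (ς x') ⊓ s = x'}, x ⊓ s := inf_sSup_eq
      _ = _ := iSup_congr fun s => iSup_congr fun hs => (hs (x ⊓ s) inf_le_right).symm
  refine ⟨hilbert_basis, fun x y h => ?_⟩
  rw [hilbert_basis x, hilbert_basis y]
  simp only [h]
end

section
/- Let X and Y be pre-Hilbert B-modules with the inner product of Y non-degenerate, and let h : X → Y be a function which is adjointable, i.e. there exists h† : Y → X with ⟨h(x), y⟩ = ⟨x, h†(y)⟩ for all x ∈ X and y ∈ Y. Then h is a homomorphism of B-modules: h(⨆_α b_α•x_α) = ⨆_α b_α•h(x_α) for every family (b_α) in B and (x_α) in X; in particular h preserves arbitrary joins and h(b•x) = b•h(x). -/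
/-- an adjointable map between pre-Hilbert `B`-modules (with the
codomain's inner product non-degenerate) is a homomorphism of `B`-modules. -/
theorem sheaves_as_modules_stmt14 {B X Y : Type*} [Order.Frame B]
    [CompleteLattice X] [CompleteLattice Y]
    (smulX : B → X → X) (innX : X → X → B)
    (smulY : B → Y → Y) (innY : Y → Y → B)
    (hX1 : ∀ x : X, smulX ⊤ x = x)
    (hX2 : ∀ (a b : B) (x : X), smulX (a ⊓ b) x = smulX a (smulX b x))
    (hX3 : ∀ (S : Set B) (x : X), smulX (sSup S) x = ⨆ b ∈ S, smulX b x)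
    (hX4 : ∀ (b : B) (T : Set X), smulX b (sSup T) = ⨆ x ∈ T, smulX b x)
    (hiX1 : ∀ (b : B) (x y : X), innX (smulX b x) y = b ⊓ innX x y)
    (hiX2 : ∀ (T : Set X) (y : X), innX (sSup T) y = ⨆ x ∈ T, innX x y)
    (hiX3 : ∀ x y : X, innX x y = innX y x)
    (hY1 : ∀ y : Y, smulY ⊤ y = y)
    (hY2 : ∀ (a b : B) (y : Y), smulY (a ⊓ b) y = smulY a (smulY b y))
    (hY3 : ∀ (S : Set B) (y : Y), smulY (sSup S) y = ⨆ b ∈ S, smulY b y)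
    (hY4 : ∀ (b : B) (T : Set Y), smulY b (sSup T) = ⨆ y ∈ T, smulY b y)
    (hiY1 : ∀ (b : B) (x y : Y), innY (smulY b x) y = b ⊓ innY x y)
    (hiY2 : ∀ (T : Set Y) (y : Y), innY (sSup T) y = ⨆ x ∈ T, innY x y)
    (hiY3 : ∀ x y : Y, innY x y = innY y x)
    (hndY : ∀ x y : Y, (∀ z : Y, innY x z = innY y z) → x = y)
    (h : X → Y) (hdag : Y → X)
    (hadj : ∀ (x : X) (y : Y), innY (h x) y = innX x (hdag y)) :
    -- h is a homomorphism of B-modules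
    (∀ (ι : Type*) (b : ι → B) (x : ι → X),
      h (⨆ i, smulX (b i) (x i)) = ⨆ i, smulY (b i) (h (x i))) ∧
    -- in particular h preserves arbitrary joins …
    (∀ T : Set X, h (sSup T) = ⨆ x ∈ T, h x) ∧
    -- … and is equivariant
    (∀ (b : B) (x : X), h (smulX b x) = smulY b (h x)) := by
  have equivariant : ∀ (b : B) (x : X), h (smulX b x) = smulY b (h x) := fun b x =>
    hndY _ _ fun z => by rw [hadj, hiX1, hiY1, hadj]
  have map_sSup : ∀ T : Set X, h (sSup T) = ⨆ x ∈ T, h x := fun T =>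
    hndY _ _ fun z => by
      rw [← sSup_image, hadj, hiX2, hiY2, iSup_image]
      simp only [hadj]
  refine ⟨fun ι b x => ?_, map_sSup, equivariant⟩
  rw [← sSup_range, map_sSup, iSup_range]
  simp only [equivariant]
end

section
/- Let X and Y be pre-Hilbert B-modules such that X has a Hilbert basis 𝒮, and let h : X → Y be a homomorphism of B-modules (h preserves arbitrary joins and h(b•x) = b•h(x)). Then h is adjointable with a unique adjoint: the map h† : Y → X defined by h†(y) = ⨆_{t∈𝒮} ⟨h(t), y⟩•t satisfies ⟨h(x), y⟩ = ⟨x, h†(y)⟩ for all x ∈ X and y ∈ Y, and any function k : Y → X with ⟨h(x), y⟩ = ⟨x, k(y)⟩ for all x, y equals h†. -/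
/-- A map preserving suprema of sets preserves suprema of families indexed by a set. -/
theorem map_biSup_of_map_sSup {ι α β : Type*} [CompleteLattice α] [CompleteLattice β]
    {f : α → β} (hf : ∀ T : Set α, f (sSup T) = ⨆ x ∈ T, f x) (S : Set ι) (g : ι → α) :
    f (⨆ t ∈ S, g t) = ⨆ t ∈ S, f (g t) := by
  rw [← sSup_image, hf, iSup_image]

/-- every `B`-module homomorphism from a pre-Hilbert `B`-module
with a Hilbert basis is adjointable, with unique adjoint
`h† y = ⨆_{t∈𝒮} ⟨h t, y⟩ • t`. -/
theorem sheaves_as_modules_stmt15 {B X Y : Type*} [Order.Frame B]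
    [CompleteLattice X] [CompleteLattice Y]
    (smulX : B → X → X) (innX : X → X → B)
    (smulY : B → Y → Y) (innY : Y → Y → B)
    (hX1 : ∀ x : X, smulX ⊤ x = x)
    (hX2 : ∀ (a b : B) (x : X), smulX (a ⊓ b) x = smulX a (smulX b x))
    (hX3 : ∀ (S : Set B) (x : X), smulX (sSup S) x = ⨆ b ∈ S, smulX b x)
    (hX4 : ∀ (b : B) (T : Set X), smulX b (sSup T) = ⨆ x ∈ T, smulX b x)
    (hiX1 : ∀ (b : B) (x y : X), innX (smulX b x) y = b ⊓ innX x y)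
    (hiX2 : ∀ (T : Set X) (y : X), innX (sSup T) y = ⨆ x ∈ T, innX x y)
    (hiX3 : ∀ x y : X, innX x y = innX y x)
    (hY1 : ∀ y : Y, smulY ⊤ y = y)
    (hY2 : ∀ (a b : B) (y : Y), smulY (a ⊓ b) y = smulY a (smulY b y))
    (hY3 : ∀ (S : Set B) (y : Y), smulY (sSup S) y = ⨆ b ∈ S, smulY b y)
    (hY4 : ∀ (b : B) (T : Set Y), smulY b (sSup T) = ⨆ y ∈ T, smulY b y)
    (hiY1 : ∀ (b : B) (x y : Y), innY (smulY b x) y = b ⊓ innY x y)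
    (hiY2 : ∀ (T : Set Y) (y : Y), innY (sSup T) y = ⨆ x ∈ T, innY x y)
    (hiY3 : ∀ x y : Y, innY x y = innY y x)
    (𝒮 : Set X)
    (hbasis : ∀ x : X, x = ⨆ s ∈ 𝒮, smulX (innX x s) s)
    (h : X → Y)
    (hjoins : ∀ T : Set X, h (sSup T) = ⨆ x ∈ T, h x)
    (hequiv : ∀ (b : B) (x : X), h (smulX b x) = smulY b (h x)) :
    -- h† y = ⨆_{t∈𝒮} ⟨h t, y⟩ • t is an adjoint of h …
    (∀ (x : X) (y : Y),
      innY (h x) y = innX x (⨆ t ∈ 𝒮, smulX (innY (h t) y) t)) ∧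
    -- … and it is the unique adjoint
    (∀ k : Y → X, (∀ (x : X) (y : Y), innY (h x) y = innX x (k y)) →
      k = fun y => ⨆ t ∈ 𝒮, smulX (innY (h t) y) t) := by
  refine ⟨fun x y => ?_, fun k hk => funext fun y => ?_⟩
  · conv_lhs => rw [hbasis x]
    rw [map_biSup_of_map_sSup hjoins,
      map_biSup_of_map_sSup (f := fun z => innY z y) (fun T => hiY2 T y), hiX3,
      map_biSup_of_map_sSup (f := fun z => innX z x) (fun T => hiX2 T x)]
    exact biSup_congr fun t _ => by rw [hequiv, hiY1, hiX1, hiX3 x, inf_comm]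
  · exact (hbasis (k y)).trans (biSup_congr fun t _ => by rw [hk, hiX3])
end

section
/- Let X and Y be étale B-locales with frame homomorphisms φ_X : B → X, φ_Y : B → Y and supports ς_X, ς_Y. Let f* : Y → X be a frame homomorphism with f* ∘ φ_Y = φ_X, and suppose f* has a left adjoint f_! : X → Y satisfying the Frobenius condition f_!(x ⊓ f*(y)) = f_!(x) ⊓ y for all x ∈ X, y ∈ Y. Then f_! is the operator adjoint of f* with respect to the inner products ⟨x,x'⟩_X = ς_X(x ⊓ x') and ⟨y,y'⟩_Y = ς_Y(y ⊓ y'): that is, ς_X(x ⊓ f*(y)) = ς_Y(f_!(x) ⊓ y) for all x ∈ X and y ∈ Y. -/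
/-- for a map `f` of étale `B`-locales, the direct image `f_!` is
the operator adjoint of `f*` with respect to the inner products
`⟨x,x'⟩ = ς (x ⊓ x')`: `ς_X (x ⊓ f* y) = ς_Y (f_! x ⊓ y)`. -/
theorem sheaves_as_modules_stmt16 {B X Y : Type*}
    [Order.Frame B] [Order.Frame X] [Order.Frame Y]
    (φX : B → X) (φY : B → Y) (ςX : X → B) (ςY : Y → B)
    (hφXS : ∀ S : Set B, φX (sSup S) = ⨆ b ∈ S, φX b)
    (hφXI : ∀ a b : B, φX (a ⊓ b) = φX a ⊓ φX b)
    (hφXT : φX ⊤ = ⊤)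
    (hφYS : ∀ S : Set B, φY (sSup S) = ⨆ b ∈ S, φY b)
    (hφYI : ∀ a b : B, φY (a ⊓ b) = φY a ⊓ φY b)
    (hφYT : φY ⊤ = ⊤)
    (hadjX : ∀ (x : X) (b : B), ςX x ≤ b ↔ x ≤ φX b)
    (hequivX : ∀ (b : B) (x : X), ςX (φX b ⊓ x) = b ⊓ ςX x)
    (hadjY : ∀ (y : Y) (b : B), ςY y ≤ b ↔ y ≤ φY b)
    (hequivY : ∀ (b : B) (y : Y), ςY (φY b ⊓ y) = b ⊓ ςY y)
    (hetaleX : sSup {s : X | ∀ x ≤ s, φX (ςX x) ⊓ s = x} = ⊤)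
    (hetaleY : sSup {s : Y | ∀ y ≤ s, φY (ςY y) ⊓ s = y} = ⊤)
    (fs : Y → X) (fl : X → Y)
    (hfsS : ∀ S : Set Y, fs (sSup S) = ⨆ y ∈ S, fs y)
    (hfsI : ∀ a b : Y, fs (a ⊓ b) = fs a ⊓ fs b)
    (hfsT : fs ⊤ = ⊤)
    (hover : ∀ b : B, fs (φY b) = φX b)
    (hadjf : ∀ (x : X) (y : Y), fl x ≤ y ↔ x ≤ fs y)
    (hfrob : ∀ (x : X) (y : Y), fl (x ⊓ fs y) = fl x ⊓ y) :
    ∀ (x : X) (y : Y), ςX (x ⊓ fs y) = ςY (fl x ⊓ y) := by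
  intro x y
  rw [← hfrob]
  exact eq_of_forall_ge_iff fun b => by rw [hadjX, hadjY, hadjf, hover]
end

section
/- Let X be an étale B-locale with frame homomorphism φ and support ς, and let S ⊆ 𝒮_X be a non-empty set of local sections such that ⨆S is again a local section. Then ς(⨅S) = ⨅_{t∈S} ς(t). -/
/-- in an étale `B`-locale, if `S` is a non-empty set of local
sections whose join is again a local section, then the support of the meet of
`S` is the meet of the supports. -/
theorem sheaves_as_modules_stmt17 {B X : Type*} [Order.Frame B] [Order.Frame X]
    (φ : B → X) (ς : X → B)
    (hφS : ∀ S : Set B, φ (sSup S) = ⨆ b ∈ S, φ b)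
    (hφI : ∀ a b : B, φ (a ⊓ b) = φ a ⊓ φ b)
    (hφT : φ ⊤ = ⊤)
    (hadj : ∀ (x : X) (b : B), ς x ≤ b ↔ x ≤ φ b)
    (hequiv : ∀ (b : B) (x : X), ς (φ b ⊓ x) = b ⊓ ς x)
    (hetale : sSup {s : X | ∀ x ≤ s, φ (ς x) ⊓ s = x} = ⊤)
    (S : Set X)
    (hne : S.Nonempty)
    (hsec : ∀ s ∈ S, ∀ x ≤ s, φ (ς x) ⊓ s = x)
    (hsup : ∀ x ≤ sSup S, φ (ς x) ⊓ sSup S = x) :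
    ς (sInf S) = ⨅ t ∈ S, ς t := by
  have gc : GaloisConnection ς φ := hadj
  apply le_antisymm
  · exact le_iInf₂ fun t ht => gc.monotone_l (sInf_le ht)
  · obtain ⟨t₀, ht₀⟩ := hne
    have hb : (⨅ t ∈ S, ς t) ≤ ς (sSup S) :=
      (iInf₂_le t₀ ht₀).trans (gc.monotone_l (le_sSup ht₀))
    have hle : φ (⨅ t ∈ S, ς t) ⊓ sSup S ≤ sInf S := le_sInf fun t ht =>
      calc φ (⨅ t ∈ S, ς t) ⊓ sSup S ≤ φ (ς t) ⊓ sSup S :=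
            inf_le_inf_right _ (gc.monotone_u (iInf₂_le t ht))
        _ = t := hsup t (le_sSup ht)
    calc (⨅ t ∈ S, ς t) = ς (φ (⨅ t ∈ S, ς t) ⊓ sSup S) := by
          rw [hequiv, inf_eq_left.mpr hb]
      _ ≤ ς (sInf S) := gc.monotone_l hle
end

section
/- Let X and Y be étale B-locales with frame homomorphisms φ_X, φ_Y and supports ς_X, ς_Y, and let h : X → Y be a sheaf homomorphism. Let k : Y → X be an adjoint of h with respect to the inner products ⟨x,x'⟩_X = ς_X(x ⊓ x') and ⟨y,y'⟩_Y = ς_Y(y ⊓ y'), i.e. ς_Y(h(x) ⊓ y) = ς_X(x ⊓ k(y)) for all x ∈ X, y ∈ Y. Then k preserves arbitrary meets: k(⨅S) = ⨅_{y∈S} k(y) for every subset S ⊆ Y. -/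
/-- A local section `s` lies below `z` as soon as `s ⊓ z` has the same support as `s`. -/
theorem le_iff_support_inf_eq {B X : Type*} [Order.Frame X] {φ : B → X} {ς : X → B} {s : X}
    (hs : ∀ x ≤ s, φ (ς x) ⊓ s = x) (z : X) : s ≤ z ↔ ς (s ⊓ z) = ς s := by
  refine ⟨fun hsz => by rw [inf_eq_left.mpr hsz], fun heq => ?_⟩
  have hsz := hs (s ⊓ z) inf_le_left
  rw [heq, hs s le_rfl] at hsz
  exact inf_eq_left.mp hsz.symm

/-- Elements below a local section are local sections. -/
theorem localSection_of_le {B X : Type*} [Order.Frame X] {φ : B → X} {ς : X → B} {s t : X}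
    (hs : ∀ x ≤ s, φ (ς x) ⊓ s = x) (hts : t ≤ s) : ∀ x ≤ t, φ (ς x) ⊓ t = x := by
  intro x hx
  rw [← inf_eq_right.mpr hts, ← inf_assoc, hs x (hx.trans hts), inf_eq_left.mpr hx]

/-- If local sections cover, every element is the join of the local sections below it. -/
theorem sSup_localSections_le_eq {B X : Type*} [Order.Frame X] {φ : B → X} {ς : X → B}
    (hcover : sSup {s : X | ∀ x ≤ s, φ (ς x) ⊓ s = x} = ⊤) (x : X) :
    sSup {t : X | (∀ z ≤ t, φ (ς z) ⊓ t = z) ∧ t ≤ x} = x := by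
  refine le_antisymm (sSup_le fun t ht => ht.2) ?_
  conv_lhs => rw [← inf_top_eq x, ← hcover, inf_sSup_eq]
  exact iSup₂_le fun s hs => le_sSup ⟨localSection_of_le hs inf_le_right, inf_le_left⟩

/-- the operator adjoint of a sheaf homomorphism between étale
`B`-locales preserves arbitrary meets. -/
theorem sheaves_as_modules_stmt18 {B X Y : Type*}
    [Order.Frame B] [Order.Frame X] [Order.Frame Y]
    (φX : B → X) (φY : B → Y) (ςX : X → B) (ςY : Y → B)
    (hφXS : ∀ S : Set B, φX (sSup S) = ⨆ b ∈ S, φX b)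
    (hφXI : ∀ a b : B, φX (a ⊓ b) = φX a ⊓ φX b)
    (hφXT : φX ⊤ = ⊤)
    (hφYS : ∀ S : Set B, φY (sSup S) = ⨆ b ∈ S, φY b)
    (hφYI : ∀ a b : B, φY (a ⊓ b) = φY a ⊓ φY b)
    (hφYT : φY ⊤ = ⊤)
    (hadjX : ∀ (x : X) (b : B), ςX x ≤ b ↔ x ≤ φX b)
    (hequivX : ∀ (b : B) (x : X), ςX (φX b ⊓ x) = b ⊓ ςX x)
    (hadjY : ∀ (y : Y) (b : B), ςY y ≤ b ↔ y ≤ φY b)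
    (hequivY : ∀ (b : B) (y : Y), ςY (φY b ⊓ y) = b ⊓ ςY y)
    (hetaleX : sSup {s : X | ∀ x ≤ s, φX (ςX x) ⊓ s = x} = ⊤)
    (hetaleY : sSup {s : Y | ∀ y ≤ s, φY (ςY y) ⊓ s = y} = ⊤)
    -- h is a sheaf homomorphism
    (h : X → Y)
    (hjoins : ∀ T : Set X, h (sSup T) = ⨆ x ∈ T, h x)
    (hequivh : ∀ (b : B) (x : X), h (φX b ⊓ x) = φY b ⊓ h x)
    (hsec : ∀ s : X, (∀ x ≤ s, φX (ςX x) ⊓ s = x) →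
      (∀ y ≤ h s, φY (ςY y) ⊓ h s = y))
    (hsupp : ∀ s : X, (∀ x ≤ s, φX (ςX x) ⊓ s = x) → ςY (h s) = ςX s)
    -- k is an operator adjoint of h
    (k : Y → X)
    (hadjk : ∀ (x : X) (y : Y), ςY (h x ⊓ y) = ςX (x ⊓ k y)) :
    -- k preserves arbitrary meets
    ∀ S : Set Y, k (sInf S) = ⨅ y ∈ S, k y := by
  have hsection : ∀ s : X, (∀ x ≤ s, φX (ςX x) ⊓ s = x) → ∀ y, h s ≤ y ↔ s ≤ k y := by
    intro s hs y
    rw [le_iff_support_inf_eq (hsec s hs) y, le_iff_support_inf_eq hs (k y), hadjk, hsupp s hs]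
  have hgc : GaloisConnection h k := by
    intro x y
    rw [← sSup_localSections_le_eq hetaleX x, hjoins, iSup₂_le_iff, sSup_le_iff]
    exact forall₂_congr fun t ht => hsection t ht.1 y
  exact fun S => hgc.u_sInf
end

section
/- Let X and Y be étale B-locales with frame homomorphisms φ_X, φ_Y and supports ς_X, ς_Y, and let h : X → Y be a sheaf homomorphism. Let k : Y → X be the adjoint of h, i.e. ς_Y(h(x) ⊓ y) = ς_X(x ⊓ k(y)) for all x ∈ X, y ∈ Y. Then k is a frame homomorphism (preserving arbitrary joins, binary meets and ⊤), satisfies k ∘ φ_Y = φ_X, and h is left adjoint to k (h(x) ≤ y ⟺ x ≤ k(y) for all x, y). Consequently, the assignment f* ↦ f_! (left adjoint) is a bijection from the set of frame homomorphisms g : Y → X with g ∘ φ_Y = φ_X onto the set of sheaf homomorphisms X → Y. -/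
/-- A map between complete lattices preserving joins has a right adjoint. -/
theorem gc_of_map_sSup {X Y : Type*} [CompleteLattice X] [CompleteLattice Y] {h : X → Y}
    (hjoins : ∀ T : Set X, h (sSup T) = ⨆ x ∈ T, h x) :
    GaloisConnection h fun y => sSup {x | h x ≤ y} := by
  have hmono : Monotone h := fun a b hab => by
    have hsup := hjoins {a, b}
    rw [sSup_pair, sup_eq_right.2 hab, iSup_pair] at hsup
    exact hsup ▸ le_sup_left
  refine fun x y => ⟨fun hxy => le_sSup hxy, fun hxy => (hmono hxy).trans ?_⟩
  rw [hjoins]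
  exact iSup₂_le fun _ hx => hx

/-- `s` is a local section of the open `B`-locale with structure map `φ` and support `ς`. -/
def IsLocalSection {B X : Type*} [Order.Frame X] (φ : B → X) (ς : X → B) (s : X) : Prop :=
  ∀ x ≤ s, φ (ς x) ⊓ s = x

theorem IsLocalSection.mono {B X : Type*} [Order.Frame B] [Order.Frame X] {φ : B → X} {ς : X → B}
    (hadj : GaloisConnection ς φ) {s t : X} (hs : IsLocalSection φ ς s) (hts : t ≤ s) :
    IsLocalSection φ ς t := fun x hx =>
  le_antisymm ((inf_le_inf_left _ hts).trans (hs x (hx.trans hts)).le) (le_inf (hadj.le_u_l x) hx)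

/-- In an étale `B`-locale every element is the join of the local sections below it. -/
theorem le_of_forall_isLocalSection_le {B X : Type*} [Order.Frame B] [Order.Frame X]
    {φ : B → X} {ς : X → B} (hadj : GaloisConnection ς φ)
    (hetale : sSup {s : X | IsLocalSection φ ς s} = ⊤) {x z : X}
    (H : ∀ s ≤ x, IsLocalSection φ ς s → s ≤ z) : x ≤ z := by
  rw [← inf_top_eq x, ← hetale, inf_sSup_eq]
  exact iSup₂_le fun s hs => H _ inf_le_left (IsLocalSection.mono hadj hs inf_le_right)

section SheafHom

variable {B X Y : Type*} [Order.Frame B] [Order.Frame X] [Order.Frame Y]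
  {φX : B → X} {φY : B → Y} {ςX : X → B} {ςY : Y → B}

/-- The operator adjoint of a sheaf homomorphism is its right adjoint. -/
theorem gc_of_operator_adjoint (hadjX : GaloisConnection ςX φX)
    (hetaleX : sSup {s : X | IsLocalSection φX ςX s} = ⊤) {h : X → Y} {r k : Y → X}
    (hr : GaloisConnection h r)
    (hsec : ∀ s, IsLocalSection φX ςX s → IsLocalSection φY ςY (h s))
    (hsupp : ∀ s, IsLocalSection φX ςX s → ςY (h s) = ςX s)
    (hadjk : ∀ x y, ςY (h x ⊓ y) = ςX (x ⊓ k y)) : GaloisConnection h k := by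
  intro x y
  constructor
  · intro hxy
    refine le_of_forall_isLocalSection_le hadjX hetaleX fun s hsx hs => ?_
    have key : ςX s = ςX (s ⊓ k y) := by
      rw [← hadjk, inf_eq_left.2 ((hr.monotone_l hsx).trans hxy), hsupp s hs]
    rw [← inf_eq_left, ← hs _ inf_le_left, ← key, hs s le_rfl]
  · intro hxy
    rw [hr]
    refine le_of_forall_isLocalSection_le hadjX hetaleX fun s hsx hs => ?_
    rw [← hr s y]
    have key : ςY (h s ⊓ y) = ςY (h s) := by
      rw [hadjk, inf_eq_left.2 (hsx.trans hxy), hsupp s hs]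
    rw [← inf_eq_left, ← hsec s hs _ inf_le_left, key, hsec s hs _ le_rfl]

/-- The right adjoint of a sheaf homomorphism commutes with the structure maps. -/
theorem right_adjoint_comp_structure (hadjX : GaloisConnection ςX φX)
    (hadjY : GaloisConnection ςY φY)
    (hetaleX : sSup {s : X | IsLocalSection φX ςX s} = ⊤) {h : X → Y} {r : Y → X}
    (hr : GaloisConnection h r)
    (hsupp : ∀ s, IsLocalSection φX ςX s → ςY (h s) = ςX s) (b : B) : r (φY b) = φX b := by
  have key : ∀ s, IsLocalSection φX ςX s → (s ≤ r (φY b) ↔ s ≤ φX b) := fun s hs => by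
    rw [← hr s, ← hadjY (h s), hsupp s hs, hadjX s]
  exact le_antisymm
    (le_of_forall_isLocalSection_le hadjX hetaleX fun s hsx hs => (key s hs).1 hsx)
    (le_of_forall_isLocalSection_le hadjX hetaleX fun s hsx hs => (key s hs).2 hsx)

/-- The right adjoint of a sheaf homomorphism preserves joins. -/
theorem right_adjoint_sSup (hφXS : ∀ S : Set B, φX (sSup S) = ⨆ b ∈ S, φX b)
    (hadjX : GaloisConnection ςX φX) (hadjY : GaloisConnection ςY φY)
    (hetaleX : sSup {s : X | IsLocalSection φX ςX s} = ⊤) {h : X → Y} {r : Y → X}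
    (hr : GaloisConnection h r) (hequivh : ∀ b x, h (φX b ⊓ x) = φY b ⊓ h x)
    (hsec : ∀ s, IsLocalSection φX ςX s → IsLocalSection φY ςY (h s))
    (hsupp : ∀ s, IsLocalSection φX ςX s → ςY (h s) = ςX s) (S : Set Y) :
    r (sSup S) = ⨆ y ∈ S, r y := by
  refine le_antisymm ?_ (iSup₂_le fun y hy => hr.monotone_u (le_sSup hy))
  refine le_of_forall_isLocalSection_le hadjX hetaleX fun s hsx hs => ?_
  rw [← hr s] at hsx
  have hcover : s ≤ φX (sSup ((fun y => ςY (h s ⊓ y)) '' S)) := by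
    rw [← hadjX s, ← hsupp s hs, hadjY (h s)]
    refine (le_inf le_rfl hsx).trans ?_
    rw [inf_sSup_eq]
    exact iSup₂_le fun y hy => (hadjY _ _).1 (le_sSup ⟨y, hy, rfl⟩)
  rw [hφXS, iSup_image] at hcover
  rw [← inf_eq_right.2 hcover, iSup₂_inf_eq]
  refine iSup₂_mono fun y _ => ?_
  rw [← hr _ y, hequivh, hsec s hs _ inf_le_left]
  exact inf_le_right

end SheafHom

section DirectImage

variable {B X Y : Type*} [Order.Frame B] [Order.Frame X] [Order.Frame Y]

/-- The direct image along `g : Y → X`, computed on the local sections of `Y`. -/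
def directImage (φY : B → Y) (ςX : X → B) (ςY : Y → B) (g : Y → X) (x : X) : Y :=
  ⨆ t ∈ {t : Y | IsLocalSection φY ςY t}, φY (ςX (x ⊓ g t)) ⊓ t

variable {φX : B → X} {φY : B → Y} {ςX : X → B} {ςY : Y → B} {g : Y → X}

theorem gc_directImage (hadjX : GaloisConnection ςX φX) (hadjY : GaloisConnection ςY φY)
    (hetaleY : sSup {s : Y | IsLocalSection φY ςY s} = ⊤)
    (hgS : ∀ S : Set Y, g (sSup S) = ⨆ y ∈ S, g y) (hgI : ∀ a b, g (a ⊓ b) = g a ⊓ g b)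
    (hgT : g ⊤ = ⊤) (hgφ : ∀ b, g (φY b) = φX b) :
    GaloisConnection (directImage φY ςX ςY g) g := by
  have hmono : Monotone g := fun a b hab => by
    rw [← inf_eq_left.2 hab, hgI]
    exact inf_le_right
  intro x y
  constructor
  · intro hxy
    refine le_trans ?_ (hmono hxy)
    have hcover : x ≤ ⨆ t ∈ {t : Y | IsLocalSection φY ςY t}, x ⊓ g t := by
      rw [← inf_iSup₂_eq, ← hgS, hetaleY, hgT, inf_top_eq]
    refine hcover.trans (iSup₂_le fun t ht => ?_)
    have ht' : φY (ςX (x ⊓ g t)) ⊓ t ≤ directImage φY ςX ςY g x :=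
      le_iSup₂ (f := fun t (_ : t ∈ {t : Y | IsLocalSection φY ςY t}) =>
        φY (ςX (x ⊓ g t)) ⊓ t) t ht
    refine le_trans ?_ (hmono ht')
    rw [hgI, hgφ]
    exact le_inf (hadjX.le_u_l _) inf_le_right
  · intro hxy
    refine iSup₂_le fun t ht => ?_
    have hle : ςX (x ⊓ g t) ≤ ςY (y ⊓ t) := by
      rw [hadjX _ _, ← hgφ]
      refine le_trans ?_ (hmono (hadjY.le_u_l _))
      rw [hgI]
      exact inf_le_inf_right _ hxy
    calc φY (ςX (x ⊓ g t)) ⊓ t ≤ φY (ςY (y ⊓ t)) ⊓ t := inf_le_inf_right _ (hadjY.monotone_u hle)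
      _ = y ⊓ t := ht _ inf_le_right
      _ ≤ y := inf_le_left

/-- Frobenius reciprocity for the direct image. -/
theorem directImage_inf (hφYI : ∀ a b, φY (a ⊓ b) = φY a ⊓ φY b)
    (hequivX : ∀ b x, ςX (φX b ⊓ x) = b ⊓ ςX x)
    (hgI : ∀ a b, g (a ⊓ b) = g a ⊓ g b) (hgφ : ∀ b, g (φY b) = φX b) (x : X) (y : Y) :
    directImage φY ςX ςY g (x ⊓ g y) = directImage φY ςX ςY g x ⊓ y := by
  unfold directImage
  rw [iSup₂_inf_eq]
  refine iSup_congr fun t => iSup_congr fun ht => ?_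
  have hty : φY (ςY (y ⊓ t)) ⊓ t = y ⊓ t := ht _ inf_le_right
  have hg : x ⊓ g y ⊓ g t = φX (ςY (y ⊓ t)) ⊓ (x ⊓ g t) := by
    rw [inf_assoc, ← hgI, ← hty, hgI, hgφ, hty, inf_left_comm]
  rw [hg, hequivX, hφYI, inf_right_comm, hty, inf_right_comm, inf_assoc, inf_comm,
    inf_assoc, inf_comm t]

/-- The left adjoint of a frame homomorphism over `B` preserves supports. -/
theorem support_left_adjoint (hadjX : GaloisConnection ςX φX) (hadjY : GaloisConnection ςY φY)
    {h : X → Y} (hg : GaloisConnection h g) (hgφ : ∀ b, g (φY b) = φX b) (x : X) :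
    ςY (h x) = ςX x :=
  eq_of_forall_ge_iff fun b => by rw [hadjY _ _, hg _ _, hgφ, hadjX _ _]

/-- A support-preserving left adjoint satisfying Frobenius reciprocity preserves local sections. -/
theorem isLocalSection_left_adjoint (hadjY : GaloisConnection ςY φY) {h : X → Y}
    (hg : GaloisConnection h g) (hgφ : ∀ b, g (φY b) = φX b)
    (hfrob : ∀ x y, h (x ⊓ g y) = h x ⊓ y) (hsupp : ∀ x, ςY (h x) = ςX x) {s : X}
    (hs : IsLocalSection φX ςX s) : IsLocalSection φY ςY (h s) := by
  intro y hy
  refine le_antisymm ?_ (le_inf (hadjY.le_u_l y) hy)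
  have hsy : ςX (s ⊓ g y) = ςY y := by rw [← hsupp, hfrob, inf_eq_right.2 hy]
  rw [inf_comm, ← hfrob, hg _ _, hgφ, inf_comm, ← hsy, hs _ inf_le_left]
  exact inf_le_right

end DirectImage

/-- the operator adjoint `k` of a sheaf homomorphism `h` between
étale `B`-locales is a frame homomorphism over `B` and `h` is its left adjoint;
consequently taking left adjoints is a bijection from frame homomorphisms
`Y → X` over `B` onto sheaf homomorphisms `X → Y`. -/
theorem sheaves_as_modules_stmt19 {B X Y : Type*}
    [Order.Frame B] [Order.Frame X] [Order.Frame Y]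
    (φX : B → X) (φY : B → Y) (ςX : X → B) (ςY : Y → B)
    (hφXS : ∀ S : Set B, φX (sSup S) = ⨆ b ∈ S, φX b)
    (hφXI : ∀ a b : B, φX (a ⊓ b) = φX a ⊓ φX b)
    (hφXT : φX ⊤ = ⊤)
    (hφYS : ∀ S : Set B, φY (sSup S) = ⨆ b ∈ S, φY b)
    (hφYI : ∀ a b : B, φY (a ⊓ b) = φY a ⊓ φY b)
    (hφYT : φY ⊤ = ⊤)
    (hadjX : ∀ (x : X) (b : B), ςX x ≤ b ↔ x ≤ φX b)
    (hequivX : ∀ (b : B) (x : X), ςX (φX b ⊓ x) = b ⊓ ςX x)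
    (hadjY : ∀ (y : Y) (b : B), ςY y ≤ b ↔ y ≤ φY b)
    (hequivY : ∀ (b : B) (y : Y), ςY (φY b ⊓ y) = b ⊓ ςY y)
    (hetaleX : sSup {s : X | ∀ x ≤ s, φX (ςX x) ⊓ s = x} = ⊤)
    (hetaleY : sSup {s : Y | ∀ y ≤ s, φY (ςY y) ⊓ s = y} = ⊤)
    -- h is a sheaf homomorphism
    (h : X → Y)
    (hjoins : ∀ T : Set X, h (sSup T) = ⨆ x ∈ T, h x)
    (hequivh : ∀ (b : B) (x : X), h (φX b ⊓ x) = φY b ⊓ h x)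
    (hsec : ∀ s : X, (∀ x ≤ s, φX (ςX x) ⊓ s = x) →
      (∀ y ≤ h s, φY (ςY y) ⊓ h s = y))
    (hsupp : ∀ s : X, (∀ x ≤ s, φX (ςX x) ⊓ s = x) → ςY (h s) = ςX s)
    -- k is the operator adjoint of h
    (k : Y → X)
    (hadjk : ∀ (x : X) (y : Y), ςY (h x ⊓ y) = ςX (x ⊓ k y)) :
    -- predicates: frame homomorphisms over B, sheaf homomorphisms, left adjoints
    let FrameHomOver : (Y → X) → Prop := fun g =>
      (∀ S : Set Y, g (sSup S) = ⨆ y ∈ S, g y) ∧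
      (∀ a b : Y, g (a ⊓ b) = g a ⊓ g b) ∧
      g ⊤ = ⊤ ∧
      (∀ b : B, g (φY b) = φX b)
    let SheafHom : (X → Y) → Prop := fun h' =>
      (∀ T : Set X, h' (sSup T) = ⨆ x ∈ T, h' x) ∧
      (∀ (b : B) (x : X), h' (φX b ⊓ x) = φY b ⊓ h' x) ∧
      (∀ s : X, (∀ x ≤ s, φX (ςX x) ⊓ s = x) →
        (∀ y ≤ h' s, φY (ςY y) ⊓ h' s = y)) ∧
      (∀ s : X, (∀ x ≤ s, φX (ςX x) ⊓ s = x) → ςY (h' s) = ςX s)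
    let LAdj : (X → Y) → (Y → X) → Prop := fun h' g =>
      ∀ (x : X) (y : Y), h' x ≤ y ↔ x ≤ g y
    -- k is a frame homomorphism over B and h is left adjoint to it
    FrameHomOver k ∧
    LAdj h k ∧
    -- taking left adjoints is a bijection from frame homomorphisms over B
    -- onto sheaf homomorphisms:
    -- every frame homomorphism over B has a left adjoint which is a sheaf hom
    (∀ g : Y → X, FrameHomOver g → ∃ h' : X → Y, SheafHom h' ∧ LAdj h' g) ∧
    -- the assignment is injective
    (∀ (g₁ g₂ : Y → X) (h' : X → Y), FrameHomOver g₁ → FrameHomOver g₂ →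
      LAdj h' g₁ → LAdj h' g₂ → g₁ = g₂) ∧
    -- and surjective onto sheaf homomorphisms
    (∀ h' : X → Y, SheafHom h' → ∃ g : Y → X, FrameHomOver g ∧ LAdj h' g) := by
  intro FrameHomOver SheafHom LAdj
  have frameHom_of_ladj : ∀ (h' : X → Y) (g : Y → X), SheafHom h' → LAdj h' g →
      FrameHomOver g := fun h' g ⟨_, hequiv, hs, hσ⟩ hg =>
    have hgc : GaloisConnection h' g := hg
    ⟨right_adjoint_sSup hφXS hadjX hadjY hetaleX hgc hequiv hs hσ,
      fun _ _ => hgc.u_inf, hgc.u_top, right_adjoint_comp_structure hadjX hadjY hetaleX hgc hσ⟩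
  have exists_ladj : ∀ h' : X → Y, SheafHom h' → ∃ g : Y → X, LAdj h' g := fun h' hh' =>
    ⟨_, gc_of_map_sSup hh'.1⟩
  have hh : SheafHom h := ⟨hjoins, hequivh, hsec, hsupp⟩
  obtain ⟨r, hr⟩ := exists_ladj h hh
  have hk : LAdj h k := gc_of_operator_adjoint hadjX hetaleX hr hsec hsupp hadjk
  refine ⟨frameHom_of_ladj h k hh hk, hk, ?_, ?_, ?_⟩
  · rintro g ⟨hgS, hgI, hgT, hgφ⟩
    have hg := gc_directImage hadjX hadjY hetaleY hgS hgI hgT hgφ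
    have hfrob := directImage_inf (ςY := ςY) hφYI hequivX hgI hgφ
    have hσ := support_left_adjoint hadjX hadjY hg hgφ
    refine ⟨directImage φY ςX ςY g, ⟨fun T => hg.l_sSup, fun b x => ?_, fun s hs => ?_,
      fun s _ => hσ s⟩, hg⟩
    · rw [inf_comm, ← hgφ, hfrob, inf_comm]
    · exact isLocalSection_left_adjoint hadjY hg hgφ hfrob hσ hs
  · intro g₁ g₂ h' _ _ h₁ h₂
    exact funext fun y => eq_of_forall_le_iff fun x => (h₁ x y).symm.trans (h₂ x y)
  · intro h' hh'
    obtain ⟨g, hg⟩ := exists_ladj h' hh'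
    exact ⟨g, frameHom_of_ladj h' g hh' hg, hg⟩
end
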